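/- arXiv:2304.00269 — 4 statements merged into one kernel-verified Lean document; each statement's English description precedes it below -/
import Mathlib

section
/- Let N ≥ 1, m > 1, 0 < p < 1 with m + p < 2, and let u : ℝ^N × (0,T) → (0,∞) be a classical solution of ∂_t u = Δ(u^m) + u^p of class C^∞ such that, with v = (m/(m−1)) u^{m−1}, the functions v and ∇v are bounded on ℝ^N × (0,T) and v is uniformly bounded below by a positive constant (v ≥ δ > 0). Then the Aronson–Bénilan estimate Δv(x,t) ≥ −N/((N(m−1)+2) t) holds for every (x,t) ∈ ℝ^N × (0,T). -/
open MeasureTheory Set Filter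
open scoped RealInnerProductSpace

noncomputable section

/-- The spatial Laplacian of a function on `EuclideanSpace ℝ (Fin N)`. -/
def lapl {N : ℕ} (f : EuclideanSpace ℝ (Fin N) → ℝ) (x : EuclideanSpace ℝ (Fin N)) : ℝ :=
  ∑ i : Fin N,
    fderiv ℝ (fun y => fderiv ℝ f y (EuclideanSpace.single i (1 : ℝ))) x
      (EuclideanSpace.single i (1 : ℝ))

open scoped ContDiff

/-- The derivative of `f` in the fixed direction `a`, as a function of the base point. -/
def dirD {V : Type*} [NormedAddCommGroup V] [NormedSpace ℝ V] (a : V) (f : V → ℝ) (z : V) : ℝ :=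
  fderiv ℝ f z a

section DirD

variable {V : Type*} [NormedAddCommGroup V] [NormedSpace ℝ V] {Ω : Set V} {f g : V → ℝ}

theorem ContDiffOn.dirD (hΩ : IsOpen Ω) (hf : ContDiffOn ℝ ∞ f Ω) (a : V) :
    ContDiffOn ℝ ∞ (dirD a f) Ω :=
  (hf.fderiv_of_isOpen hΩ (m := ∞) (by simp)).clm_apply contDiffOn_const

theorem ContDiffOn.differentiableAt_of_isOpen (hΩ : IsOpen Ω) (hf : ContDiffOn ℝ ∞ f Ω)
    {z : V} (hz : z ∈ Ω) : DifferentiableAt ℝ f z :=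
  (hf.contDiffAt (hΩ.mem_nhds hz)).differentiableAt (by simp)

theorem dirD_congr (hΩ : IsOpen Ω) (h : EqOn f g Ω) (a : V) : EqOn (dirD a f) (dirD a g) Ω := by
  intro z hz
  have : f =ᶠ[nhds z] g := h.eventuallyEq_of_mem (hΩ.mem_nhds hz)
  simp only [dirD, this.fderiv_eq]

theorem dirD_add (hΩ : IsOpen Ω) (hf : ContDiffOn ℝ ∞ f Ω) (hg : ContDiffOn ℝ ∞ g Ω) (a : V) :
    EqOn (dirD a fun z => f z + g z) (fun z => dirD a f z + dirD a g z) Ω := by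
  intro z hz
  simp only [dirD]
  rw [fderiv_fun_add (hf.differentiableAt_of_isOpen hΩ hz) (hg.differentiableAt_of_isOpen hΩ hz)]
  rfl

theorem dirD_mul (hΩ : IsOpen Ω) (hf : ContDiffOn ℝ ∞ f Ω) (hg : ContDiffOn ℝ ∞ g Ω) (a : V) :
    EqOn (dirD a fun z => f z * g z) (fun z => dirD a f z * g z + f z * dirD a g z) Ω := by
  intro z hz
  simp only [dirD]
  rw [fderiv_fun_mul (hf.differentiableAt_of_isOpen hΩ hz) (hg.differentiableAt_of_isOpen hΩ hz)]
  simp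
  ring

theorem dirD_const_mul (hΩ : IsOpen Ω) (hf : ContDiffOn ℝ ∞ f Ω) (c : ℝ) (a : V) :
    EqOn (dirD a fun z => c * f z) (fun z => c * dirD a f z) Ω := by
  intro z hz
  simp only [dirD]
  rw [fderiv_const_mul (hf.differentiableAt_of_isOpen hΩ hz)]
  simp

theorem dirD_sum {ι : Type*} [Fintype ι] (hΩ : IsOpen Ω) {F : ι → V → ℝ}
    (hF : ∀ i, ContDiffOn ℝ ∞ (F i) Ω) (a : V) :
    EqOn (dirD a fun z => ∑ i, F i z) (fun z => ∑ i, dirD a (F i) z) Ω := by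
  intro z hz
  simp only [dirD]
  rw [fderiv_fun_sum fun i _ => (hF i).differentiableAt_of_isOpen hΩ hz]
  simp

theorem ContDiffOn.rpow_const_of_pos (hf : ContDiffOn ℝ ∞ f Ω) (hpos : ∀ z ∈ Ω, 0 < f z) (r : ℝ) :
    ContDiffOn ℝ ∞ (fun z => f z ^ r) Ω :=
  hf.rpow_const_of_ne fun z hz => (hpos z hz).ne'

theorem dirD_rpow (hΩ : IsOpen Ω) (hf : ContDiffOn ℝ ∞ f Ω) (hpos : ∀ z ∈ Ω, 0 < f z) (r : ℝ)
    (a : V) : EqOn (dirD a fun z => f z ^ r) (fun z => r * (f z ^ (r - 1) * dirD a f z)) Ω := by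
  intro z hz
  simp only [dirD]
  rw [((hf.differentiableAt_of_isOpen hΩ hz).hasFDerivAt.rpow_const
    (Or.inl (hpos z hz).ne')).fderiv]
  simp
  ring

theorem dirD_comm (hΩ : IsOpen Ω) (hf : ContDiffOn ℝ ∞ f Ω) (a b : V) :
    EqOn (dirD a (dirD b f)) (dirD b (dirD a f)) Ω := by
  intro z hz
  have hd : DifferentiableAt ℝ (fderiv ℝ f) z :=
    ((hf.fderiv_of_isOpen hΩ (m := ∞) (by simp)).contDiffAt
      (hΩ.mem_nhds hz)).differentiableAt (by simp)
  have hs : IsSymmSndFDerivAt ℝ f z :=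
    (hf.contDiffAt (hΩ.mem_nhds hz)).isSymmSndFDerivAt (by
    simpa using WithTop.coe_le_coe.2 (le_top : (2 : ℕ∞) ≤ ⊤))
  have key : ∀ c d : V, dirD c (dirD d f) z = fderiv ℝ (fderiv ℝ f) z c d := by
    intro c d
    change fderiv ℝ (fun y => fderiv ℝ f y d) z c = _
    rw [fderiv_clm_apply hd (differentiableAt_const d)]
    simp
  rw [key, key, hs.eq]

theorem dirD_dirD_mul (hΩ : IsOpen Ω) (hf : ContDiffOn ℝ ∞ f Ω) (hg : ContDiffOn ℝ ∞ g Ω) (a : V) :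
    EqOn (dirD a (dirD a fun z => f z * g z))
      (fun z => dirD a (dirD a f) z * g z + 2 * (dirD a f z * dirD a g z)
        + f z * dirD a (dirD a g) z) Ω := by
  have hf' := hf.dirD hΩ a
  have hg' := hg.dirD hΩ a
  intro z hz
  rw [dirD_congr hΩ (dirD_mul hΩ hf hg a) a hz, dirD_add hΩ (hf'.mul hg) (hf.mul hg') a hz]
  simp only [dirD_mul hΩ hf' hg a hz, dirD_mul hΩ hf hg' a hz]
  ring

theorem dirD_dirD_add (hΩ : IsOpen Ω) (hf : ContDiffOn ℝ ∞ f Ω) (hg : ContDiffOn ℝ ∞ g Ω) (a : V) :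
    EqOn (dirD a (dirD a fun z => f z + g z))
      (fun z => dirD a (dirD a f) z + dirD a (dirD a g) z) Ω := by
  intro z hz
  rw [dirD_congr hΩ (dirD_add hΩ hf hg a) a hz]
  exact dirD_add hΩ (hf.dirD hΩ a) (hg.dirD hΩ a) a hz

theorem dirD_dirD_const_mul (hΩ : IsOpen Ω) (hf : ContDiffOn ℝ ∞ f Ω) (c : ℝ) (a : V) :
    EqOn (dirD a (dirD a fun z => c * f z)) (fun z => c * dirD a (dirD a f) z) Ω := by
  intro z hz
  rw [dirD_congr hΩ (dirD_const_mul hΩ hf c a) a hz]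
  exact dirD_const_mul hΩ (hf.dirD hΩ a) c a hz

theorem dirD_dirD_sum {ι : Type*} [Fintype ι] (hΩ : IsOpen Ω) {F : ι → V → ℝ}
    (hF : ∀ i, ContDiffOn ℝ ∞ (F i) Ω) (a : V) :
    EqOn (dirD a (dirD a fun z => ∑ i, F i z)) (fun z => ∑ i, dirD a (dirD a (F i)) z) Ω := by
  intro z hz
  rw [dirD_congr hΩ (dirD_sum hΩ hF a) a hz]
  exact dirD_sum hΩ (fun i => (hF i).dirD hΩ a) a hz

theorem dirD_dirD_rpow (hΩ : IsOpen Ω) (hf : ContDiffOn ℝ ∞ f Ω) (hpos : ∀ z ∈ Ω, 0 < f z)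
    (r : ℝ) (a : V) : EqOn (dirD a (dirD a fun z => f z ^ r))
      (fun z => r * ((r - 1) * (f z ^ (r - 2) * dirD a f z ^ 2)
        + f z ^ (r - 1) * dirD a (dirD a f) z)) Ω := by
  intro z hz
  have hf' := hf.dirD hΩ a
  have hfr := hf.rpow_const_of_pos hpos (r - 1)
  rw [dirD_congr hΩ (dirD_rpow hΩ hf hpos r a) a hz, dirD_const_mul hΩ (hfr.mul hf') r a hz]
  simp only [dirD_mul hΩ hfr hf' a hz, dirD_rpow hΩ hf hpos (r - 1) a hz]
  rw [show r - 1 - 1 = r - 2 by ring]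
  ring

end DirD

section Pressure

variable {V : Type*} [NormedAddCommGroup V] [NormedSpace ℝ V] {ι : Type*} [Fintype ι]

/-- The sum of the second derivatives in the directions `e i`. -/
def sumSq (e : ι → V) (f : V → ℝ) (z : V) : ℝ := ∑ i, dirD (e i) (dirD (e i) f) z

theorem ContDiffOn.sumSq {Ω : Set V} {f : V → ℝ} (hΩ : IsOpen Ω) (hf : ContDiffOn ℝ ∞ f Ω)
    (e : ι → V) : ContDiffOn ℝ ∞ (sumSq e f) Ω :=
  ContDiffOn.sum fun i _ => (hf.dirD hΩ (e i)).dirD hΩ (e i)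

theorem dirD_sumSq {Ω : Set V} {f : V → ℝ} (hΩ : IsOpen Ω) (hf : ContDiffOn ℝ ∞ f Ω)
    (e : ι → V) (b : V) : EqOn (dirD b (sumSq e f)) (sumSq e (dirD b f)) Ω := by
  intro z hz
  change dirD b (fun z => ∑ i, dirD (e i) (dirD (e i) f) z) z = _
  rw [dirD_sum hΩ (fun i => (hf.dirD hΩ (e i)).dirD hΩ (e i)) b hz]
  refine Finset.sum_congr rfl fun i _ => ?_
  rw [dirD_comm hΩ (hf.dirD hΩ (e i)) b (e i) hz, dirD_congr hΩ (dirD_comm hΩ hf b (e i)) (e i) hz]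

/-- The pressure equation. -/
theorem pressure_equation {Ω : Set V} (hΩ : IsOpen Ω) {u : V → ℝ} (hu : ContDiffOn ℝ ∞ u Ω)
    (hpos : ∀ z ∈ Ω, 0 < u z) {m p : ℝ} (hm : 1 < m) (e : ι → V) (b : V)
    (heq : ∀ z ∈ Ω, dirD b u z = sumSq e (fun y => u y ^ m) z + u z ^ p)
    {v : V → ℝ} (hv : v = fun z => m / (m - 1) * u z ^ (m - 1)) :
    EqOn (dirD b v) (fun z => (m - 1) * (v z * sumSq e v z) + ∑ i, dirD (e i) v z * dirD (e i) v z
      + m * u z ^ (m + p - 2)) Ω := by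
  intro z hz
  have hm1 : m - 1 ≠ 0 := by linarith
  have hD : ∀ a, dirD a v z = m * (u z ^ (m - 2) * dirD a u z) := by
    intro a
    rw [hv, dirD_const_mul hΩ (hu.rpow_const_of_pos hpos _) _ a hz]
    simp only [dirD_rpow hΩ hu hpos _ a hz]
    rw [show m - 1 - 1 = m - 2 by ring]
    field_simp
  have hDD : ∀ a, dirD a (dirD a v) z = m * ((m - 2) * (u z ^ (m - 3) * dirD a u z ^ 2)
        + u z ^ (m - 2) * dirD a (dirD a u) z) := by
    intro a
    rw [hv, dirD_dirD_const_mul hΩ (hu.rpow_const_of_pos hpos _) _ a hz]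
    simp only [dirD_dirD_rpow hΩ hu hpos _ a hz]
    rw [show m - 1 - 1 = m - 2 by ring, show m - 1 - 2 = m - 3 by ring]
    field_simp
  have hU := hpos z hz
  have h1 : u z ^ (m - 1) = u z ^ (m - 2) * u z := by
    rw [← Real.rpow_add_one hU.ne']; congr 1; ring
  have h2 : u z ^ (m - 2) = u z ^ (m - 3) * u z := by
    rw [← Real.rpow_add_one hU.ne']; congr 1; ring
  have h3 : u z ^ (m + p - 2) = u z ^ (m - 2) * u z ^ p := by
    rw [← Real.rpow_add hU]; congr 1; ring
  rw [hD b, heq z hz]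
  beta_reduce
  rw [h3]
  have hvz : v z = m / (m - 1) * u z ^ (m - 1) := by rw [hv]
  simp only [sumSq, hD, hDD, dirD_dirD_rpow hΩ hu hpos _ _ hz, hvz, h1, h2]
  have : ∀ i, (m - 1) * (m / (m - 1) * (u z ^ (m - 3) * u z * u z) *
      (m * ((m - 2) * (u z ^ (m - 3) * dirD (e i) u z ^ 2)
        + u z ^ (m - 3) * u z * dirD (e i) (dirD (e i) u) z)))
      + m * (u z ^ (m - 3) * u z * dirD (e i) u z) * (m * (u z ^ (m - 3) * u z * dirD (e i) u z))
      = m * (u z ^ (m - 3) * u z * (m * ((m - 1) * (u z ^ (m - 3) * u z * dirD (e i) u z ^ 2) +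
            u z ^ (m - 3) * u z * u z * dirD (e i) (dirD (e i) u) z))) := by
    intro i
    field_simp
    ring
  rw [mul_add, mul_add, Finset.mul_sum, Finset.mul_sum, Finset.mul_sum, Finset.mul_sum,
    ← Finset.sum_add_distrib]
  simp only [this]

/-- The differential inequality satisfied by the Laplacian of the pressure. -/
theorem lapl_pressure_inequality [Nonempty ι] {Ω : Set V} (hΩ : IsOpen Ω) {u : V → ℝ}
    (hu : ContDiffOn ℝ ∞ u Ω) (hpos : ∀ z ∈ Ω, 0 < u z) {m p : ℝ} (hm : 1 < m) (hp1 : p < 1)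
    (hmp : m + p < 2) (e : ι → V) (b : V)
    (heq : ∀ z ∈ Ω, dirD b u z = sumSq e (fun y => u y ^ m) z + u z ^ p)
    {v : V → ℝ} (hv : v = fun z => m / (m - 1) * u z ^ (m - 1)) {z : V} (hz : z ∈ Ω) :
    (m - 1) * (v z * sumSq e (sumSq e v) z)
      + 2 * m * ∑ i, dirD (e i) v z * dirD (e i) (sumSq e v) z
      + (m - 1 + 2 / Fintype.card ι) * sumSq e v z ^ 2
      + (m + p - 2) * (u z ^ (p - 1) * sumSq e v z) ≤ dirD b (sumSq e v) z := by
  have hm1 : m - 1 ≠ 0 := by linarith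
  have hvs : ContDiffOn ℝ ∞ v Ω := by
    rw [hv]; exact contDiffOn_const.mul (hu.rpow_const_of_pos hpos _)
  have hws := hvs.sumSq hΩ e
  have hU := hpos z hz
  have hG := hu.rpow_const_of_pos hpos (m + p - 2)
  have hvi := fun i => hvs.dirD hΩ (e i)
  have hS : ContDiffOn ℝ ∞ (fun z => ∑ i, dirD (e i) v z * dirD (e i) v z) Ω :=
    ContDiffOn.sum fun i _ => (hvi i).mul (hvi i)
  have hvw : ContDiffOn ℝ ∞ (fun z => v z * sumSq e v z) Ω := hvs.mul hws
  have hexp : ∀ j, dirD (e j) (dirD (e j) (dirD b v)) z =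
      (m - 1) * (dirD (e j) (dirD (e j) v) z * sumSq e v z
        + 2 * (dirD (e j) v z * dirD (e j) (sumSq e v) z)
        + v z * dirD (e j) (dirD (e j) (sumSq e v)) z)
      + ∑ i, (dirD (e j) (dirD (e j) (dirD (e i) v)) z * dirD (e i) v z
        + 2 * (dirD (e j) (dirD (e i) v) z * dirD (e j) (dirD (e i) v) z)
        + dirD (e i) v z * dirD (e j) (dirD (e j) (dirD (e i) v)) z)
      + m * dirD (e j) (dirD (e j) fun z => u z ^ (m + p - 2)) z := by
    intro j
    rw [dirD_congr hΩ (dirD_congr hΩ (pressure_equation hΩ hu hpos hm e b heq hv) _) _ hz,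
      dirD_dirD_add hΩ ((contDiffOn_const.mul hvw).add hS) (contDiffOn_const.mul hG) _ hz]
    simp only [dirD_dirD_add hΩ (contDiffOn_const.mul hvw) hS _ hz,
      dirD_dirD_const_mul hΩ hvw _ _ hz, dirD_dirD_const_mul hΩ hG _ _ hz,
      dirD_dirD_mul hΩ hvs hws _ hz, dirD_dirD_sum hΩ (fun i => (hvi i).mul (hvi i)) _ hz,
      dirD_dirD_mul hΩ (hvi _) (hvi _) _ hz]
  have hreact : ∀ j, (m + p - 2) * (u z ^ (p - 1) * dirD (e j) (dirD (e j) v) z)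
      ≤ m * dirD (e j) (dirD (e j) fun z => u z ^ (m + p - 2)) z := by
    intro j
    have hDD : dirD (e j) (dirD (e j) v) z = m * ((m - 2) * (u z ^ (m - 3) * dirD (e j) u z ^ 2)
          + u z ^ (m - 2) * dirD (e j) (dirD (e j) u) z) := by
      rw [hv, dirD_dirD_const_mul hΩ (hu.rpow_const_of_pos hpos _) _ (e j) hz]
      simp only [dirD_dirD_rpow hΩ hu hpos _ (e j) hz]
      rw [show m - 1 - 1 = m - 2 by ring, show m - 1 - 2 = m - 3 by ring]
      field_simp
    rw [hDD, dirD_dirD_rpow hΩ hu hpos _ (e j) hz]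
    have h1 : u z ^ (m + p - 2 - 1) = u z ^ (p - 1) * u z ^ (m - 2) := by
      rw [← Real.rpow_add hU]; congr 1; ring
    have h2 : u z ^ (m + p - 2 - 2) = u z ^ (p - 1) * u z ^ (m - 3) := by
      rw [← Real.rpow_add hU]; congr 1; ring
    simp only [h1, h2]
    have : 0 ≤ m * ((2 - m - p) * (1 - p)) *
        (u z ^ (p - 1) * u z ^ (m - 3) * dirD (e j) u z ^ 2) := by
      have h3 : 0 ≤ 2 - m - p := by linarith
      have h4 : 0 ≤ 1 - p := by linarith
      positivity
    linarith
  have hlap : ∀ i, ∑ j, dirD (e j) (dirD (e j) (dirD (e i) v)) z = dirD (e i) (sumSq e v) z :=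
    fun i => (dirD_sumSq hΩ hvs e (e i) hz).symm
  have htrace : 2 / Fintype.card ι * sumSq e v z ^ 2 ≤
      ∑ j, ∑ i, 2 * (dirD (e j) (dirD (e i) v) z * dirD (e j) (dirD (e i) v) z) := by
    have hc : (0 : ℝ) < Fintype.card ι := by exact_mod_cast Fintype.card_pos
    have h1 : sumSq e v z ^ 2 ≤ Fintype.card ι * ∑ j, dirD (e j) (dirD (e j) v) z ^ 2 :=
      sq_sum_le_card_mul_sum_sq
    have h2 : ∑ j, 2 * dirD (e j) (dirD (e j) v) z ^ 2 ≤
        ∑ j, ∑ i, 2 * (dirD (e j) (dirD (e i) v) z * dirD (e j) (dirD (e i) v) z) := by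
      refine Finset.sum_le_sum fun j _ => ?_
      rw [pow_two]
      exact Finset.single_le_sum
        (f := fun i => 2 * (dirD (e j) (dirD (e i) v) z * dirD (e j) (dirD (e i) v) z))
        (fun i _ => mul_nonneg two_pos.le (mul_self_nonneg _)) (Finset.mem_univ j)
    rw [← Finset.mul_sum] at h2
    refine le_trans ?_ h2
    rw [div_mul_eq_mul_div, div_le_iff₀ hc]
    linarith
  have hcross : ∑ j, ∑ i, dirD (e i) v z * dirD (e j) (dirD (e j) (dirD (e i) v)) z
      = ∑ i, dirD (e i) v z * dirD (e i) (sumSq e v) z := by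
    rw [Finset.sum_comm]
    simp only [← Finset.mul_sum, hlap]
  have hsum : ∑ j, (m + p - 2) * (u z ^ (p - 1) * dirD (e j) (dirD (e j) v) z) ≤
      ∑ j, m * dirD (e j) (dirD (e j) fun z => u z ^ (m + p - 2)) z :=
    Finset.sum_le_sum fun j _ => hreact j
  rw [← Finset.mul_sum, ← Finset.mul_sum, ← Finset.mul_sum] at hsum
  rw [dirD_sumSq hΩ hvs e b hz, sumSq.eq_1 e (dirD b v)]
  simp only [hexp, Finset.sum_add_distrib, ← Finset.mul_sum, ← Finset.sum_mul]
  simp only [← Finset.mul_sum] at htrace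
  simp only [mul_comm _ (dirD (e _) v z)]
  simp only [hcross]
  simp only [sumSq.eq_1 e (sumSq e v)]
  have hw : ∑ j, dirD (e j) (dirD (e j) v) z = sumSq e v z := rfl
  rw [hw] at hsum ⊢
  linarith

end Pressure

section Comparison

theorem second_deriv_nonneg_of_isLocalMin {f f' : ℝ → ℝ} {f'' a : ℝ} (hmin : IsLocalMin f a)
    (hf' : ∀ᶠ s in nhds a, HasDerivAt f (f' s) s)
    (hf'' : HasDerivAt f' f'' a) : 0 ≤ f'' := by
  by_contra! h
  have hd : deriv f =ᶠ[nhds a] f' := hf'.mono fun s hs => hs.deriv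
  have hdd : deriv (deriv f) a = f'' := by rw [hd.deriv_eq, hf''.deriv]
  have hmax : IsLocalMax f a := isLocalMax_of_deriv_deriv_neg (by rwa [hdd])
    (hmin.deriv_eq_zero) hf'.self_of_nhds.continuousAt
  have hc : f =ᶠ[nhds a] fun _ => f a := by
    filter_upwards [hmin, hmax] with s h1 h2 using le_antisymm h2 h1
  have h0 : deriv f =ᶠ[nhds a] fun _ => 0 := by
    filter_upwards [hc.eventuallyEq_nhds] with s hs
    rw [hs.deriv_eq, deriv_const]
  rw [h0.deriv_eq, deriv_const] at hdd
  linarith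

theorem deriv_nonpos_of_left_min {f : ℝ → ℝ} {f' a : ℝ} (hf : HasDerivAt f f' a)
    (hmin : ∀ᶠ s in nhdsWithin a (Iio a), f a ≤ f s) : f' ≤ 0 := by
  have h := (hasDerivAt_iff_tendsto_slope_left_right.1 hf).1
  refine le_of_tendsto h ?_
  filter_upwards [hmin, self_mem_nhdsWithin] with s hs hsa
  rw [slope_def_field]
  exact div_nonpos_of_nonneg_of_nonpos (sub_nonneg.2 hs) (sub_nonpos.2 (le_of_lt hsa))

theorem ContDiffOn.hasDerivAt_line {V : Type*} [NormedAddCommGroup V] [NormedSpace ℝ V]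
    {Ω : Set V} {f : V → ℝ} (hΩ : IsOpen Ω) (hf : ContDiffOn ℝ ∞ f Ω) (z a : V) {s : ℝ}
    (hs : z + s • a ∈ Ω) : HasDerivAt (fun s => f (z + s • a)) (_root_.dirD a f (z + s • a)) s := by
  have h1 : HasDerivAt (fun s : ℝ => z + s • a) a s := by
    simpa using ((hasDerivAt_id s).smul_const a).const_add z
  exact (hf.differentiableAt_of_isOpen hΩ hs).hasFDerivAt.comp_hasDerivAt s h1

theorem hasDerivAt_barrier (l r y s : ℝ) (h : r - 2 * s * y - s ^ 2 ≠ 0) :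
    HasDerivAt (fun s => l / (r - 2 * s * y - s ^ 2) ^ 2)
      (4 * l * (y + s) / (r - 2 * s * y - s ^ 2) ^ 3) s := by
  have hq : HasDerivAt (fun s => r - 2 * s * y - s ^ 2) (-(2 * y) - 2 * s) s := by
    have := (((hasDerivAt_id s).const_mul 2).mul_const y).const_sub r |>.sub (hasDerivAt_pow 2 s)
    refine this.congr_deriv ?_
    simp
  refine ((hasDerivAt_const s l).div (hq.pow 2) (pow_ne_zero 2 h)).congr_deriv ?_
  simp only [Pi.pow_apply]
  field_simp
  ring

theorem hasDerivAt_deriv_barrier (l r y : ℝ) (h : r ≠ 0) :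
    HasDerivAt (fun s => 4 * l * (y + s) / (r - 2 * s * y - s ^ 2) ^ 3)
      (4 * l / r ^ 3 + 24 * l * y ^ 2 / r ^ 4) 0 := by
  have hq : HasDerivAt (fun s => r - 2 * s * y - s ^ 2) (-(2 * y)) 0 := by
    have := (((hasDerivAt_id (0 : ℝ)).const_mul 2).mul_const y).const_sub r |>.sub
      (hasDerivAt_pow 2 (0 : ℝ))
    refine this.congr_deriv ?_
    simp
  have hn : HasDerivAt (fun s => 4 * l * (y + s)) (4 * l) 0 := by
    simpa using ((hasDerivAt_id (0 : ℝ)).const_add y).const_mul (4 * l)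
  refine (hn.div (hq.pow 3) (by simpa using h)).congr_deriv ?_
  simp
  field_simp
  ring

/-- The algebraic contradiction at a negative minimum of the sum of a solution and a barrier. -/
theorem barrier_contradiction {N : ℕ} {m k C R l r θ V c W Wt : ℝ}
    {y ξ a b : Fin N → ℝ} (hm : 1 < m) (hk : 0 < k) (hC : 0 ≤ C) (hR : 1 ≤ R) (hl : 0 < l)
    (hlk : k * l = ((m - 1) * C * (4 * N + 24) + 8 * m * N * C) * R ^ 3)
    (hr : 0 < r) (hrR : r ≤ R ^ 2) (hθ : 0 < θ) (hV0 : 0 ≤ V) (hVC : V ≤ C) (hc : c ≤ 0)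
    (hy : ∑ j, y j ^ 2 ≤ R ^ 2) (hξ : ∀ j, |ξ j| ≤ C)
    (ha : ∀ j, a j = -(4 * l * y j / r ^ 3))
    (hb : ∀ j, -(4 * l / r ^ 3 + 24 * l * y j ^ 2 / r ^ 4) ≤ b j)
    (hWt : Wt ≤ 1 / (k * θ ^ 2))
    (hW : W + (1 / (k * θ) + l / r ^ 2) < 0)
    (hineq : (m - 1) * (V * ∑ j, b j) + 2 * m * ∑ j, ξ j * a j + k * W ^ 2 + c * W ≤ Wt) :
    False := by
  have hR0 : 0 < R := by linarith
  have hr4 : 0 < r ^ 4 := by positivity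
  have hcub : 1 / r ^ 3 ≤ R ^ 2 / r ^ 4 := by
    rw [div_le_div_iff₀ (by positivity) hr4]
    have : 0 < r ^ 3 := by positivity
    nlinarith
  have hbs : -((4 * N + 24) * (l * R ^ 2 / r ^ 4)) ≤ ∑ j, b j := by
    have h1 : ∑ j, -(4 * l / r ^ 3 + 24 * l * y j ^ 2 / r ^ 4) ≤ ∑ j, b j :=
      Finset.sum_le_sum fun j _ => hb j
    refine le_trans ?_ h1
    have h2 : ∑ j, -(4 * l / r ^ 3 + 24 * l * y j ^ 2 / r ^ 4)
        = -(N * (4 * l * (1 / r ^ 3)) + 24 * (l / r ^ 4) * ∑ j, y j ^ 2) := by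
      rw [Finset.sum_neg_distrib, Finset.sum_add_distrib, Finset.mul_sum]
      simp only [Finset.sum_const, Finset.card_univ, Fintype.card_fin, nsmul_eq_mul, mul_one_div]
      congr 2
      exact Finset.sum_congr rfl fun j _ => by ring
    rw [h2]
    have h3 : N * (4 * l * (1 / r ^ 3)) ≤ N * (4 * l * (R ^ 2 / r ^ 4)) := by gcongr
    have h4 : 24 * (l / r ^ 4) * ∑ j, y j ^ 2 ≤ 24 * (l / r ^ 4) * R ^ 2 := by gcongr
    have h5 : (4 * N + 24) * (l * R ^ 2 / r ^ 4)
      = N * (4 * l * (R ^ 2 / r ^ 4)) + 24 * (l / r ^ 4) * R ^ 2 := by ring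
    linarith
  have hyj : ∀ j, |y j| ≤ R := fun j => abs_le_of_sq_le_sq
    ((Finset.single_le_sum (f := fun j => y j ^ 2) (fun i _ => sq_nonneg _)
      (Finset.mem_univ j)).trans hy) hR0.le
  have has : -(N * (4 * C * (l * R ^ 3 / r ^ 4))) ≤ ∑ j, ξ j * a j := by
    have h1 : ∀ j ∈ Finset.univ, -(4 * C * (l * R ^ 3 / r ^ 4)) ≤ ξ j * a j := by
      intro j _
      have h2 : ξ j * y j ≤ C * R := (le_abs_self _).trans (by
        rw [abs_mul]; exact mul_le_mul (hξ j) (hyj j) (abs_nonneg _) hC)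
      have h3 : ξ j * a j = -(4 * l * (1 / r ^ 3) * (ξ j * y j)) := by rw [ha]; ring
      have h4 : 4 * l * (1 / r ^ 3) * (ξ j * y j) ≤ 4 * l * (R ^ 2 / r ^ 4) * (C * R) :=
        calc _ ≤ 4 * l * (1 / r ^ 3) * (C * R) := by gcongr
          _ ≤ _ := by gcongr
      rw [h3]
      have h5 : 4 * l * (R ^ 2 / r ^ 4) * (C * R) = 4 * C * (l * R ^ 3 / r ^ 4) := by ring
      linarith
    have := Finset.sum_le_sum h1
    simpa using this
  have hX : 0 ≤ l * R ^ 2 / r ^ 4 := by positivity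
  have hXY : l * R ^ 2 / r ^ 4 ≤ l * R ^ 3 / r ^ 4 := by
    gcongr
    norm_num
  have hVb : -(C * ((4 * N + 24) * (l * R ^ 3 / r ^ 4))) ≤ V * ∑ j, b j := by
    have h1 : V * -((4 * N + 24) * (l * R ^ 2 / r ^ 4)) ≤ V * ∑ j, b j := by gcongr
    have h2 : V * ((4 * N + 24) * (l * R ^ 2 / r ^ 4)) ≤ C * ((4 * N + 24) * (l * R ^ 3 / r ^ 4)) := by
      gcongr
    linarith
  have hθp : 0 < 1 / (k * θ) := by positivity
  have hlp : 0 < l / r ^ 2 := by positivity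
  have hW2 : (1 / (k * θ)) ^ 2 + (l / r ^ 2) ^ 2 < W ^ 2 := by nlinarith
  have hcW : 0 ≤ c * W := mul_nonneg_of_nonpos_of_nonpos hc (by linarith)
  have hk1 : k * (1 / (k * θ)) ^ 2 = 1 / (k * θ ^ 2) := by field_simp
  have hk2 : k * (l / r ^ 2) ^ 2 =
      ((m - 1) * C * (4 * N + 24) + 8 * m * N * C) * (l * R ^ 3 / r ^ 4) := by
    have : k * (l / r ^ 2) ^ 2 = (k * l) * l / r ^ 4 := by ring
    rw [this, hlk]; ring
  have e1 := mul_lt_mul_of_pos_left hW2 hk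
  have e2 := mul_le_mul_of_nonneg_left hVb (by linarith : 0 ≤ m - 1)
  have e3 := mul_le_mul_of_nonneg_left has (by linarith : 0 ≤ 2 * m)
  rw [mul_add, hk1, hk2] at e1
  linarith

/-- The spatial coordinate directions in space-time. -/
def spaceDir {N : ℕ} (j : Fin N) : EuclideanSpace ℝ (Fin N) × ℝ :=
  (EuclideanSpace.single j (1 : ℝ), 0)

theorem add_smul_spaceDir {N : ℕ} (z : EuclideanSpace ℝ (Fin N) × ℝ) (j : Fin N) (s : ℝ) :
    z + s • spaceDir j = (z.1 + s • EuclideanSpace.single j (1 : ℝ), z.2) := by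
  ext <;> simp [spaceDir]

theorem norm_sub_line_sq {N : ℕ} (x x₀ : EuclideanSpace ℝ (Fin N)) (j : Fin N) (s : ℝ) :
    ‖x + s • EuclideanSpace.single j (1 : ℝ) - x₀‖ ^ 2
      = ‖x - x₀‖ ^ 2 + 2 * s * (x j - x₀ j) + s ^ 2 := by
  rw [add_sub_right_comm, norm_add_sq_real, real_inner_smul_right, norm_smul,
    EuclideanSpace.inner_single_right]
  simp
  ring

/-- Local form of the lower bound, on a ball of radius `R` after time `τ`. -/
theorem local_lower_bound {N : ℕ} {T : ℝ} {w v c : EuclideanSpace ℝ (Fin N) × ℝ → ℝ}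
    {m k C : ℝ} (hm : 1 < m) (hk : 0 < k) (hC : 0 < C)
    (hw : ContDiffOn ℝ ∞ w (univ ×ˢ Ioo 0 T))
    (hv0 : ∀ z ∈ (univ : Set (EuclideanSpace ℝ (Fin N))) ×ˢ Ioo 0 T, 0 ≤ v z)
    (hvC : ∀ z ∈ (univ : Set (EuclideanSpace ℝ (Fin N))) ×ˢ Ioo 0 T, v z ≤ C)
    (hξ : ∀ z ∈ (univ : Set (EuclideanSpace ℝ (Fin N))) ×ˢ Ioo 0 T, ∀ j,
      |dirD (spaceDir j) v z| ≤ C)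
    (hc : ∀ z ∈ (univ : Set (EuclideanSpace ℝ (Fin N))) ×ˢ Ioo 0 T, c z ≤ 0)
    (hineq : ∀ z ∈ (univ : Set (EuclideanSpace ℝ (Fin N))) ×ˢ Ioo 0 T,
      (m - 1) * (v z * sumSq spaceDir w z)
        + 2 * m * ∑ j, dirD (spaceDir j) v z * dirD (spaceDir j) w z
        + k * w z ^ 2 + c z * w z ≤ dirD (0, 1) w z)
    (x₀ : EuclideanSpace ℝ (Fin N)) {τ t R l : ℝ} (hτ : 0 < τ) (hτt : τ < t) (htT : t < T)
    (hR : 1 ≤ R) (hl : 0 < l)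
    (hlk : k * l = ((m - 1) * C * (4 * N + 24) + 8 * m * N * C) * R ^ 3) :
    -(1 / (k * (t - τ)) + l / (R ^ 2) ^ 2) ≤ w (x₀, t) := by
  by_contra! hneg
  have hR0 : 0 < R := by linarith
  have hΩ : IsOpen ((univ : Set (EuclideanSpace ℝ (Fin N))) ×ˢ Ioo 0 T) := isOpen_univ.prod isOpen_Ioo
  obtain ⟨M, hM0, hM⟩ : ∃ M : ℝ, 0 < M ∧ ∀ z ∈ Metric.closedBall x₀ R ×ˢ Icc τ t, -M < w z := by
    have hcomp : IsCompact (Metric.closedBall x₀ R ×ˢ Icc τ t) :=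
      (isCompact_closedBall x₀ R).prod isCompact_Icc
    have hcont : ContinuousOn w (Metric.closedBall x₀ R ×ˢ Icc τ t) :=
      hw.continuousOn.mono (prod_mono (subset_univ _) fun s hs =>
        ⟨hτ.trans_le hs.1, hs.2.trans_lt htT⟩)
    obtain ⟨B, hB⟩ := hcomp.exists_bound_of_continuousOn hcont
    refine ⟨|B| + 1, by positivity, fun z hz => ?_⟩
    have h1 := hB z hz
    have h2 := neg_abs_le (w z)
    have h3 := le_abs_self B
    rw [Real.norm_eq_abs] at h1
    linarith
  obtain ⟨q, hq0, hq1, hqR, hqM⟩ : ∃ q : ℝ, 0 < q ∧ q ≤ 1 ∧ q < R ^ 2 ∧ q * M ≤ l := by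
    refine ⟨min (1 / 2) (l / M), by positivity, (min_le_left _ _).trans (by norm_num), ?_, ?_⟩
    · refine (min_le_left _ _).trans_lt ?_
      nlinarith
    · rw [← le_div_iff₀ hM0]
      exact min_le_right _ _
  obtain ⟨ε, hε0, hεt, hεM⟩ : ∃ ε : ℝ, 0 < ε ∧ ε < t - τ ∧ ε * (k * M) ≤ 1 := by
    have : 0 < t - τ := sub_pos.2 hτt
    refine ⟨min ((t - τ) / 2) (1 / (k * M)), by positivity, (min_le_left _ _).trans_lt (by linarith),
      ?_⟩
    rw [← le_div_iff₀ (by positivity)]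
    exact min_le_right _ _
  set S : Set (EuclideanSpace ℝ (Fin N) × ℝ) :=
    {z | q ≤ R ^ 2 - ‖z.1 - x₀‖ ^ 2 ∧ τ + ε ≤ z.2 ∧ z.2 ≤ t} with hS
  set Φ : EuclideanSpace ℝ (Fin N) × ℝ → ℝ :=
    fun z => w z + (1 / (k * (z.2 - τ)) + l / (R ^ 2 - ‖z.1 - x₀‖ ^ 2) ^ 2) with hΦ
  have hSsub : S ⊆ Metric.closedBall x₀ R ×ˢ Icc τ t := by
    rintro ⟨x, s⟩ ⟨h1, h2, h3⟩
    refine ⟨?_, by simp only at h2; linarith, h3⟩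
    rw [Metric.mem_closedBall, dist_eq_norm]
    simp only at h1
    exact abs_le_of_sq_le_sq' (by linarith) hR0.le |>.2
  have hSΩ : S ⊆ univ ×ˢ Ioo 0 T := fun z hz =>
    ⟨mem_univ _, by linarith [hz.2.1], hz.2.2.trans_lt htT⟩
  have hScl : IsClosed S := by
    have hcont : Continuous fun z : EuclideanSpace ℝ (Fin N) × ℝ => R ^ 2 - ‖z.1 - x₀‖ ^ 2 := by
      fun_prop
    exact (isClosed_le continuous_const hcont).inter
      ((isClosed_le continuous_const continuous_snd).inter
        (isClosed_le continuous_snd continuous_const))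
  have hScomp : IsCompact S :=
    ((isCompact_closedBall x₀ R).prod isCompact_Icc).of_isClosed_subset hScl hSsub
  have hΦc : ContinuousOn Φ S := by
    refine (hw.continuousOn.mono hSΩ).add (ContinuousOn.add ?_ ?_)
    · refine continuousOn_const.div (f := fun _ => (1 : ℝ))
        (g := fun z : EuclideanSpace ℝ (Fin N) × ℝ => k * (z.2 - τ))
        (by fun_prop) fun z hz => ?_
      have : 0 < z.2 - τ := by linarith [hz.2.1]
      positivity
    · refine continuousOn_const.div (f := fun _ => l)
        (g := fun z : EuclideanSpace ℝ (Fin N) × ℝ => (R ^ 2 - ‖z.1 - x₀‖ ^ 2) ^ 2)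
        (by fun_prop) fun z hz => ?_
      have : 0 < R ^ 2 - ‖z.1 - x₀‖ ^ 2 := by linarith [hz.1]
      positivity
  have hmem : (x₀, t) ∈ S := by
    refine ⟨by simpa using hqR.le, by simp only; linarith, le_rfl⟩
  obtain ⟨z, hzS, hzmin⟩ := hScomp.exists_isMinOn ⟨_, hmem⟩ hΦc
  have hΦneg : Φ z < 0 := by
    refine (hzmin hmem).trans_lt ?_
    simp only [hΦ, sub_self, norm_zero]
    simp only [ne_eq, OfNat.ofNat_ne_zero, not_false_eq_true, zero_pow, sub_zero]
    linarith
  have hwM := hM z (hSsub hzS)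
  have hzΩ := hSΩ hzS
  obtain ⟨hz1, hz2, hz3⟩ := hzS
  have hθ : 0 < z.2 - τ := by linarith
  have hr : 0 < R ^ 2 - ‖z.1 - x₀‖ ^ 2 := by linarith
  have hz1' : q < R ^ 2 - ‖z.1 - x₀‖ ^ 2 := by
    refine lt_of_le_of_ne hz1 fun h => ?_
    have h1 : M ≤ l / (R ^ 2 - ‖z.1 - x₀‖ ^ 2) ^ 2 := by
      rw [← h, le_div_iff₀ (by positivity)]
      nlinarith
    have h2 : 0 < 1 / (k * (z.2 - τ)) := by positivity
    simp only [hΦ] at hΦneg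
    linarith
  have hz2' : τ + ε < z.2 := by
    refine lt_of_le_of_ne hz2 fun h => ?_
    have h1 : M ≤ 1 / (k * (z.2 - τ)) := by
      rw [← h, le_div_iff₀ (by rw [add_sub_cancel_left]; positivity)]
      linarith
    have h2 : 0 < l / (R ^ 2 - ‖z.1 - x₀‖ ^ 2) ^ 2 := by positivity
    simp only [hΦ] at hΦneg
    linarith
  have hspace : ∀ j, dirD (spaceDir j) w z
        = -(4 * l * (z.1 j - x₀ j) / (R ^ 2 - ‖z.1 - x₀‖ ^ 2) ^ 3) ∧
      -(4 * l / (R ^ 2 - ‖z.1 - x₀‖ ^ 2) ^ 3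
        + 24 * l * (z.1 j - x₀ j) ^ 2 / (R ^ 2 - ‖z.1 - x₀‖ ^ 2) ^ 4)
        ≤ dirD (spaceDir j) (dirD (spaceDir j) w) z := by
    intro j
    set r := R ^ 2 - ‖z.1 - x₀‖ ^ 2 with hrdef
    have hlineΩ : ∀ s : ℝ, z + s • spaceDir j ∈
        (univ : Set (EuclideanSpace ℝ (Fin N))) ×ˢ Ioo 0 T := by
      intro s
      rw [add_smul_spaceDir]
      exact ⟨mem_univ _, hzΩ.2⟩
    have hq : ∀ s : ℝ, R ^ 2 - ‖(z + s • spaceDir j).1 - x₀‖ ^ 2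
        = r - 2 * s * (z.1 j - x₀ j) - s ^ 2 := by
      intro s
      rw [add_smul_spaceDir, norm_sub_line_sq, hrdef]
      ring
    have hev : ∀ᶠ s : ℝ in nhds 0, q < r - 2 * s * (z.1 j - x₀ j) - s ^ 2 := by
      have hc : Continuous fun s : ℝ => r - 2 * s * (z.1 j - x₀ j) - s ^ 2 := by fun_prop
      exact hc.continuousAt.eventually_const_lt (by simpa using hz1')
    set φ : ℝ → ℝ := fun s => w (z + s • spaceDir j)
      + l / (r - 2 * s * (z.1 j - x₀ j) - s ^ 2) ^ 2 with hφ
    have hmin : IsLocalMin φ 0 := by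
      filter_upwards [hev] with s hs
      have hsS : z + s • spaceDir j ∈ S := by
        refine ⟨?_, ?_⟩
        · rw [hq]; exact hs.le
        · rw [add_smul_spaceDir]; exact ⟨hz2, hz3⟩
      have h1 : Φ z ≤ Φ (z + s • spaceDir j) := hzmin hsS
      simp only [hΦ, hq] at h1
      rw [add_smul_spaceDir] at h1
      simp only [hφ, add_smul_spaceDir, zero_smul, add_zero]
      simp only [mul_zero, zero_mul, sub_zero, ne_eq, OfNat.ofNat_ne_zero, not_false_eq_true,
        zero_pow]
      rw [← hrdef] at h1
      linarith
    have hd : ∀ᶠ s : ℝ in nhds 0, HasDerivAt φ (dirD (spaceDir j) w (z + s • spaceDir j)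
        + 4 * l * ((z.1 j - x₀ j) + s) / (r - 2 * s * (z.1 j - x₀ j) - s ^ 2) ^ 3) s := by
      filter_upwards [hev] with s hs
      exact (hw.hasDerivAt_line hΩ z (spaceDir j) (hlineΩ s)).add
        (hasDerivAt_barrier l r _ s (hq0.trans hs).ne')
    have hdd := ((hw.dirD hΩ (spaceDir j)).hasDerivAt_line hΩ z (spaceDir j) (hlineΩ 0)).add
      (hasDerivAt_deriv_barrier l r (z.1 j - x₀ j) hr.ne')
    have h1 := hmin.hasDerivAt_eq_zero hd.self_of_nhds
    have h2 := second_deriv_nonneg_of_isLocalMin hmin hd hdd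
    simp only [zero_smul, add_zero, mul_zero, zero_mul, sub_zero, ne_eq, OfNat.ofNat_ne_zero,
      not_false_eq_true, zero_pow] at h1 h2
    exact ⟨by linarith, by linarith⟩
  have htime : dirD (0, 1) w z ≤ 1 / (k * (z.2 - τ) ^ 2) := by
    have hline : ∀ s : ℝ, z + s • ((0, 1) : EuclideanSpace ℝ (Fin N) × ℝ) = (z.1, z.2 + s) := by
      intro s; ext <;> simp
    have hd1 := hw.hasDerivAt_line hΩ z (0, 1) (s := 0) (by simpa using hzΩ)
    have hd2 : HasDerivAt (fun s : ℝ => 1 / (k * (z.2 + s - τ))) (-(1 / (k * (z.2 - τ) ^ 2))) 0 := by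
      have h1 : HasDerivAt (fun s : ℝ => k * (z.2 + s - τ)) k 0 := by
        simpa using (((hasDerivAt_id (0 : ℝ)).const_add z.2).sub_const τ).const_mul k
      refine ((hasDerivAt_const (0 : ℝ) (1 : ℝ)).div h1 (by simp; constructor <;> linarith)).congr_deriv ?_
      simp
      field_simp
    have h := deriv_nonpos_of_left_min (hd1.add hd2) ?_
    · simp only [zero_smul, add_zero] at h
      linarith
    · have hev : ∀ᶠ s : ℝ in nhdsWithin 0 (Iio 0), τ + ε < z.2 + s := by
        have hc : Continuous fun s : ℝ => z.2 + s := by fun_prop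
        exact (hc.continuousAt.eventually_const_lt (by simpa using hz2')).filter_mono
          nhdsWithin_le_nhds
      filter_upwards [hev, self_mem_nhdsWithin] with s hs hs0
      have hsS : z + s • ((0, 1) : EuclideanSpace ℝ (Fin N) × ℝ) ∈ S := by
        rw [hline]
        exact ⟨hz1, hs.le, by simp only [mem_Iio] at hs0 ⊢; linarith⟩
      have h1 : Φ z ≤ Φ (z + s • (0, 1)) := hzmin hsS
      simp only [hΦ, hline] at h1
      simp only [Pi.add_apply, hline, add_zero]
      linarith
  refine barrier_contradiction (y := fun j => z.1 j - x₀ j) hm hk hC.le hR hl hlk hr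
    (by linarith [sq_nonneg ‖z.1 - x₀‖]) hθ (hv0 z hzΩ) (hvC z hzΩ) (hc z hzΩ) ?_ (hξ z hzΩ)
    (fun j => (hspace j).1) (fun j => (hspace j).2) htime hΦneg (hineq z hzΩ)
  have : ∑ j, (z.1 j - x₀ j) ^ 2 = ‖z.1 - x₀‖ ^ 2 := by
    rw [EuclideanSpace.norm_sq_eq]
    simp
  rw [this]
  linarith

theorem global_lower_bound {N : ℕ} {T : ℝ} {w v c : EuclideanSpace ℝ (Fin N) × ℝ → ℝ}
    {m k C : ℝ} (hm : 1 < m) (hk : 0 < k) (hC : 0 < C)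
    (hw : ContDiffOn ℝ ∞ w (univ ×ˢ Ioo 0 T))
    (hv0 : ∀ z ∈ (univ : Set (EuclideanSpace ℝ (Fin N))) ×ˢ Ioo 0 T, 0 ≤ v z)
    (hvC : ∀ z ∈ (univ : Set (EuclideanSpace ℝ (Fin N))) ×ˢ Ioo 0 T, v z ≤ C)
    (hξ : ∀ z ∈ (univ : Set (EuclideanSpace ℝ (Fin N))) ×ˢ Ioo 0 T, ∀ j,
      |dirD (spaceDir j) v z| ≤ C)
    (hc : ∀ z ∈ (univ : Set (EuclideanSpace ℝ (Fin N))) ×ˢ Ioo 0 T, c z ≤ 0)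
    (hineq : ∀ z ∈ (univ : Set (EuclideanSpace ℝ (Fin N))) ×ˢ Ioo 0 T,
      (m - 1) * (v z * sumSq spaceDir w z)
        + 2 * m * ∑ j, dirD (spaceDir j) v z * dirD (spaceDir j) w z
        + k * w z ^ 2 + c z * w z ≤ dirD (0, 1) w z)
    (x₀ : EuclideanSpace ℝ (Fin N)) {t : ℝ} (ht : t ∈ Ioo 0 T) :
    -(1 / (k * t)) ≤ w (x₀, t) := by
  have hspace : ∀ τ ∈ Ioo 0 t, -(1 / (k * (t - τ))) ≤ w (x₀, t) := by
    intro τ hτ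
    set B := ((m - 1) * C * (4 * N + 24) + 8 * m * N * C) / k with hB
    have hBpos : 0 < B := by
      have : 0 < m - 1 := by linarith
      positivity
    have hlim : Tendsto (fun R : ℝ => -(1 / (k * (t - τ)) + B * R⁻¹)) atTop
        (nhds (-(1 / (k * (t - τ)) + B * 0))) :=
      ((tendsto_inv_atTop_zero.const_mul B).const_add _).neg
    rw [mul_zero, add_zero] at hlim
    refine le_of_tendsto hlim ?_
    filter_upwards [eventually_ge_atTop (1 : ℝ)] with R hR
    have hR0 : 0 < R := by linarith
    have h := local_lower_bound hm hk hC hw hv0 hvC hξ hc hineq x₀ hτ.1 hτ.2 ht.2 hR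
      (l := B * R ^ 3) (by positivity) (by rw [hB]; field_simp)
    have h2 : B * R ^ 3 / (R ^ 2) ^ 2 = B * R⁻¹ := by field_simp
    rwa [h2] at h
  have hkt : k * (t - 0) ≠ 0 := by
    rw [sub_zero]
    exact (mul_pos hk ht.1).ne'
  have hlim : Tendsto (fun τ : ℝ => -(1 / (k * (t - τ)))) (nhdsWithin 0 (Ioi 0))
      (nhds (-(1 / (k * (t - 0))))) := by
    have hc : ContinuousAt (fun τ : ℝ => -(1 / (k * (t - τ)))) 0 :=
      (ContinuousAt.div (g := fun τ => k * (t - τ)) continuousAt_const (by fun_prop) hkt).neg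
    exact hc.tendsto.mono_left nhdsWithin_le_nhds
  rw [sub_zero] at hlim
  refine le_of_tendsto hlim ?_
  filter_upwards [Ioo_mem_nhdsGT ht.1] with τ hτ using hspace τ hτ

end Comparison

theorem fderiv_slice {N : ℕ} {T : ℝ} {f : EuclideanSpace ℝ (Fin N) × ℝ → ℝ}
    (hf : ContDiffOn ℝ ∞ f (univ ×ˢ Ioo 0 T)) {t : ℝ} (ht : t ∈ Ioo 0 T)
    (x a : EuclideanSpace ℝ (Fin N)) :
    fderiv ℝ (fun y => f (y, t)) x a = dirD (a, 0) f (x, t) := by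
  have hd : DifferentiableAt ℝ f (x, t) :=
    hf.differentiableAt_of_isOpen (isOpen_univ.prod isOpen_Ioo) ⟨mem_univ _, ht⟩
  have h : HasFDerivAt (fun y => f (y, t)) _ x :=
    HasFDerivAt.comp (g := f) (f := fun y => (y, t)) x hd.hasFDerivAt
      (hasFDerivAt_prodMk_left x t)
  rw [h.fderiv]
  simp [dirD]

theorem lapl_slice {N : ℕ} {T : ℝ} {f : EuclideanSpace ℝ (Fin N) × ℝ → ℝ}
    (hf : ContDiffOn ℝ ∞ f (univ ×ˢ Ioo 0 T)) {t : ℝ} (ht : t ∈ Ioo 0 T)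
    (x : EuclideanSpace ℝ (Fin N)) :
    lapl (fun y => f (y, t)) x = sumSq spaceDir f (x, t) := by
  refine Finset.sum_congr rfl fun j _ => ?_
  simp only [fderiv_slice hf ht]
  exact fderiv_slice (hf.dirD (isOpen_univ.prod isOpen_Ioo) (spaceDir j)) ht x _

theorem deriv_slice {N : ℕ} {T : ℝ} {f : EuclideanSpace ℝ (Fin N) × ℝ → ℝ}
    (hf : ContDiffOn ℝ ∞ f (univ ×ˢ Ioo 0 T)) {t : ℝ} (ht : t ∈ Ioo 0 T)
    (x : EuclideanSpace ℝ (Fin N)) :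
    deriv (fun s => f (x, s)) t = dirD (0, 1) f (x, t) := by
  have hd : DifferentiableAt ℝ f (x, t) :=
    hf.differentiableAt_of_isOpen (isOpen_univ.prod isOpen_Ioo) ⟨mem_univ _, ht⟩
  have h : HasFDerivAt (fun s => f (x, s)) _ t :=
    HasFDerivAt.comp (g := f) (f := fun s => (x, s)) t hd.hasFDerivAt (hasFDerivAt_prodMk_right x t)
  rw [h.hasDerivAt.deriv]
  simp [dirD]

/-- Aronson–Bénilan estimate for smooth positive solutions with uniformly parabolic pressure. -/
theorem aronson_benilan_classical
    {N : ℕ} (hN : 1 ≤ N) {m p T : ℝ} (hm : 1 < m) (hp0 : 0 < p) (hp1 : p < 1)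
    (hmp : m + p < 2)
    (u : EuclideanSpace ℝ (Fin N) → ℝ → ℝ)
    (hupos : ∀ x : EuclideanSpace ℝ (Fin N), ∀ t ∈ Ioo (0:ℝ) T, 0 < u x t)
    (hureg : ContDiffOn ℝ (⊤ : ℕ∞) (Function.uncurry u) (univ ×ˢ Ioo (0:ℝ) T))
    (hueq : ∀ x : EuclideanSpace ℝ (Fin N), ∀ t ∈ Ioo (0:ℝ) T,
      deriv (u x) t = lapl (fun y => u y t ^ m) x + u x t ^ p)
    (v : EuclideanSpace ℝ (Fin N) → ℝ → ℝ)
    (hv : ∀ x t, v x t = (m / (m - 1)) * u x t ^ (m - 1))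
    (hvbdd : ∃ C : ℝ, ∀ x : EuclideanSpace ℝ (Fin N), ∀ t ∈ Ioo (0:ℝ) T,
      v x t ≤ C ∧ ‖gradient (fun y => v y t) x‖ ≤ C)
    (hvlow : ∃ δ > (0:ℝ), ∀ x : EuclideanSpace ℝ (Fin N), ∀ t ∈ Ioo (0:ℝ) T, δ ≤ v x t) :
    ∀ x : EuclideanSpace ℝ (Fin N), ∀ t ∈ Ioo (0:ℝ) T,
      -((N : ℝ) / (((N : ℝ) * (m - 1) + 2) * t)) ≤ lapl (fun y => v y t) x := by
  intro x t ht
  have hNpos : (0 : ℝ) < N := by exact_mod_cast hN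
  have hm1 : 0 < m - 1 := by linarith
  have : Nonempty (Fin N) := ⟨⟨0, hN⟩⟩
  have hΩ : IsOpen ((univ : Set (EuclideanSpace ℝ (Fin N))) ×ˢ Ioo 0 T) :=
    isOpen_univ.prod isOpen_Ioo
  obtain ⟨C, hC⟩ := hvbdd
  obtain ⟨δ, hδ, hδv⟩ := hvlow
  have hCpos : 0 < C := hδ.trans_le ((hδv x t ht).trans (hC x t ht).1)
  have hUpos : ∀ z ∈ (univ : Set (EuclideanSpace ℝ (Fin N))) ×ˢ Ioo 0 T,
      0 < Function.uncurry u z := fun z hz => hupos z.1 z.2 hz.2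
  have hVdef : Function.uncurry v = fun z => m / (m - 1) * Function.uncurry u z ^ (m - 1) :=
    funext fun z => hv z.1 z.2
  have hVs : ContDiffOn ℝ ∞ (Function.uncurry v) (univ ×ˢ Ioo 0 T) := by
    rw [hVdef]
    exact contDiffOn_const.mul (hureg.rpow_const_of_pos hUpos _)
  have heq : ∀ z ∈ (univ : Set (EuclideanSpace ℝ (Fin N))) ×ˢ Ioo 0 T,
      dirD (0, 1) (Function.uncurry u) z
        = sumSq spaceDir (fun y => Function.uncurry u y ^ m) z + Function.uncurry u z ^ p := by
    rintro ⟨y, s⟩ ⟨-, hs⟩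
    have h := hueq y s hs
    rw [← deriv_slice hureg hs, ← lapl_slice (hureg.rpow_const_of_pos hUpos m) hs]
    exact h
  have hk : 0 < m - 1 + 2 / (N : ℝ) := by positivity
  have key := global_lower_bound (w := sumSq spaceDir (Function.uncurry v))
    (v := Function.uncurry v) (c := fun z => (m + p - 2) * Function.uncurry u z ^ (p - 1))
    hm hk hCpos (hVs.sumSq hΩ spaceDir)
    (fun z hz => hδ.le.trans (hδv z.1 z.2 hz.2)) (fun z hz => (hC z.1 z.2 hz.2).1)
    (fun z hz j => ?_)
    (fun z hz => mul_nonpos_of_nonpos_of_nonneg (by linarith)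
      (Real.rpow_nonneg (hUpos z hz).le _))
    (fun z hz => ?_) x ht
  · rw [← lapl_slice hVs ht] at key
    refine le_trans (le_of_eq ?_) key
    have := ht.1
    field_simp
  · rw [← Prod.mk.eta (p := z), spaceDir, ← fderiv_slice hVs hz.2]
    have h1 : ‖fderiv ℝ (fun y => v y z.2) z.1‖ ≤ C := by
      have := (hC z.1 z.2 hz.2).2
      rwa [gradient, LinearIsometryEquiv.norm_map] at this
    refine ((fderiv ℝ (fun y => v y z.2) z.1).le_opNorm _).trans ?_
    simpa using h1
  · have h := lapl_pressure_inequality hΩ hureg hUpos hm hp1 hmp spaceDir (0, 1) heq hVdef hz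
    rw [Fintype.card_fin] at h
    linarith
end
end

section
/- Let m > 1, 0 < p < 1, σ > 0 with L := σ(m−1) + 2(p−1) > 0, and set α = (σ+2)/L, β = (m−p)/L. Let T > 0 and let f : [0,∞) → [0,∞) be a C¹ function with f^m twice differentiable on (0,∞) such that (f^m)''(ξ) − α f(ξ) + β ξ f'(ξ) + ξ^σ f(ξ)^p ≤ 0 for all ξ > 0 (f is a supersolution of the self-similar profile equation). Define z(x,t) = (T−t)^{−α} f((1+|x|)(T−t)^{β}) for x ∈ ℝ, t ∈ (0,T). Then z is a classical supersolution of the one-dimensional equation: for every x ∈ ℝ, x ≠ 0, and every t ∈ (0,T), ∂_t z(x,t) ≥ ∂²_{x}(z^m)(x,t) + (1+|x|)^σ z(x,t)^p. -/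
open Set

noncomputable section

theorem deriv_comp_affine (G : ℝ → ℝ) (a b : ℝ) :
    deriv (fun y => G (a + b * y)) = fun y => b * deriv G (a + b * y) := by
  funext y
  rw [deriv_comp_mul_left b (fun u => G (a + u)) y, deriv_comp_const_add G a (b * y),
    smul_eq_mul]

theorem deriv_deriv_const_mul_comp_affine (G : ℝ → ℝ) (k a b y : ℝ) :
    deriv (deriv (fun y => k * G (a + b * y))) y =
      k * b ^ 2 * deriv (deriv G) (a + b * y) := by
  have h : deriv (fun y => k * G (a + b * y)) =
      fun y => (k * b) * deriv G (a + b * y) := by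
    funext y
    rw [deriv_const_mul_field, deriv_comp_affine]
    ring
  rw [h, deriv_const_mul_field, deriv_comp_affine]
  ring

theorem abs_eventuallyEq_sign_mul {x : ℝ} (hx : x ≠ 0) :
    ∃ ε : ℝ, ε ^ 2 = 1 ∧ ∀ᶠ y in nhds x, |y| = ε * y := by
  rcases lt_or_gt_of_ne hx with h | h
  · refine ⟨-1, by norm_num, ?_⟩
    filter_upwards [Iio_mem_nhds h] with y hy
    rw [abs_of_neg hy]
    ring
  · refine ⟨1, by norm_num, ?_⟩
    filter_upwards [Ioi_mem_nhds h] with y hy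
    rw [abs_of_pos hy]
    ring

/-- Self-similar supersolutions in dimension one: if f is a supersolution of the
self-similar profile equation, then z(x,t) = (T-t)^(-α) f((1+|x|)(T-t)^β) is a classical
supersolution of ∂ₜu = ∂ₓₓ(u^m) + (1+|x|)^σ u^p away from x = 0. -/
theorem selfsimilar_supersolution
    {m p σ L α β T : ℝ} (hm : 1 < m) (hp0 : 0 < p) (hp1 : p < 1) (hσ : 0 < σ)
    (hL : L = σ * (m - 1) + 2 * (p - 1)) (hLpos : 0 < L)
    (hα : α = (σ + 2) / L) (hβ : β = (m - p) / L) (hT : 0 < T)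
    (f : ℝ → ℝ) (hfnonneg : ∀ ξ : ℝ, 0 ≤ ξ → 0 ≤ f ξ)
    (hfC1 : ContDiffOn ℝ 1 f (Ici 0))
    (hfm : ∀ ξ : ℝ, 0 < ξ → DifferentiableAt ℝ (fun s => f s ^ m) ξ ∧
      DifferentiableAt ℝ (deriv (fun s => f s ^ m)) ξ)
    (hsuper : ∀ ξ : ℝ, 0 < ξ →
      deriv (deriv (fun s => f s ^ m)) ξ - α * f ξ + β * ξ * deriv f ξ
        + ξ ^ σ * f ξ ^ p ≤ 0)
    (z : ℝ → ℝ → ℝ)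
    (hz : ∀ x t : ℝ, z x t = (T - t) ^ (-α) * f ((1 + |x|) * (T - t) ^ β)) :
    ∀ x : ℝ, x ≠ 0 → ∀ t ∈ Ioo (0:ℝ) T,
      deriv (deriv (fun y => z y t ^ m)) x + (1 + |x|) ^ σ * z x t ^ p
        ≤ deriv (z x) t := by
  intro x hx t ht
  have hs : 0 < T - t := sub_pos.2 ht.2
  have hr : 0 < 1 + |x| := by positivity
  have hαβ : α * (m - 1) = 2 * β + 1 := by
    rw [hα, hβ]
    field_simp
    rw [hL]
    ring
  have hαp : α * (1 - p) + 1 = β * σ := by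
    rw [hα, hβ]
    field_simp
    rw [hL]
    ring
  set s := T - t with hsdef
  have hc : 0 < s ^ β := Real.rpow_pos_of_pos hs _
  have hξ : 0 < (1 + |x|) * s ^ β := mul_pos hr hc
  set ξ := (1 + |x|) * s ^ β with hξdef
  have hspace : deriv (deriv (fun y => z y t ^ m)) x =
      s ^ (-α - 1) * deriv (deriv (fun u => f u ^ m)) ξ := by
    obtain ⟨ε, hε, hev⟩ := abs_eventuallyEq_sign_mul hx
    have heq : (fun y => z y t ^ m) =ᶠ[nhds x]
        fun y => s ^ (-α * m) * (fun u => f u ^ m) (s ^ β + (ε * s ^ β) * y) := by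
      filter_upwards [hev] with y hy
      have hy0 : 0 ≤ (1 + |y|) * s ^ β := by positivity
      rw [hz, ← hsdef, Real.mul_rpow (Real.rpow_nonneg hs.le _) (hfnonneg _ hy0),
        ← Real.rpow_mul hs.le, hy]
      ring_nf
    have harg : s ^ β + (ε * s ^ β) * x = ξ := by
      rw [hξdef, hev.self_of_nhds]
      ring
    rw [heq.deriv.deriv_eq, deriv_deriv_const_mul_comp_affine (fun u => f u ^ m), harg, mul_pow, hε, one_mul,
      ← Real.rpow_natCast, ← Real.rpow_mul hs.le, ← Real.rpow_add hs]
    congr 2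
    push_cast
    linarith
  have hreact : (1 + |x|) ^ σ * z x t ^ p = s ^ (-α - 1) * (ξ ^ σ * f ξ ^ p) := by
    rw [hz, ← hsdef, ← hξdef, Real.mul_rpow (Real.rpow_nonneg hs.le _) (hfnonneg _ hξ.le),
      ← Real.rpow_mul hs.le, show -α * p = (-α - 1) + β * σ by linarith, Real.rpow_add hs,
      Real.rpow_mul hs.le, hξdef, Real.mul_rpow hr.le hc.le]
    ring
  have htime : deriv (z x) t = s ^ (-α - 1) * (α * f ξ - β * ξ * deriv f ξ) := by
    have hf : HasDerivAt f (deriv f ξ) ξ :=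
      ((hfC1.differentiableOn one_ne_zero).differentiableAt (Ici_mem_nhds hξ)).hasDerivAt
    have hsub : HasDerivAt (fun t => T - t) (-1) t := by
      simpa using (hasDerivAt_id t).const_sub T
    have hpow (e : ℝ) : HasDerivAt (fun t => (T - t) ^ e) (-1 * e * s ^ (e - 1)) t :=
      hsub.rpow_const (Or.inl hs.ne')
    have hcomp : HasDerivAt (fun t => f ((1 + |x|) * (T - t) ^ β))
        (deriv f ξ * ((1 + |x|) * (-1 * β * s ^ (β - 1)))) t :=
      HasDerivAt.comp t (h₂ := f) hf ((hpow β).const_mul (1 + |x|))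
    rw [show z x = fun t => (T - t) ^ (-α) * f ((1 + |x|) * (T - t) ^ β) from funext (hz x),
      ((hpow (-α)).fun_mul hcomp).deriv, ← hsdef, ← hξdef, hξdef, Real.rpow_sub_one hs.ne',
      Real.rpow_sub_one hs.ne']
    ring
  rw [hspace, hreact, htime, ← mul_add]
  exact mul_le_mul_of_nonneg_left (by linarith [hsuper ξ hξ]) (Real.rpow_nonneg hs.le _)
end
end

section
/- Let N ≥ 2, m > 1, 0 < p < 1, σ > 0, and define U(x,t) = ((1−p) t)^{1/(1−p)} (1+|x|)^{σ/(1−p)} for x ∈ ℝ^N and t > 0 (note ((1−p))^{1/(1−p)} = (1/(1−p))^{1/(p−1)}). Then: (i) ∂_t U(x,t) = (1+|x|)^σ U(x,t)^p for every x ∈ ℝ^N and t > 0; (ii) Δ(U^m)(x,t) ≥ 0 for every x ≠ 0 and t > 0; consequently U is a classical subsolution: ∂_t U(x,t) ≤ Δ(U^m)(x,t) + (1+|x|)^σ U(x,t)^p for all x ≠ 0, t > 0; and (iii) U(x,t) → 0 as t → 0⁺ for every x ∈ ℝ^N, so U has zero initial datum. -/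
open MeasureTheory Set Filter
open scoped RealInnerProductSpace

noncomputable section

/-- The Laplacian of a radial function `φ ∘ ‖·‖` with `φ' r = g r * r`. -/
lemma lapl_comp_norm {N : ℕ} {φ g : ℝ → ℝ} {g' : ℝ} {x : EuclideanSpace ℝ (Fin N)} (hx : x ≠ 0)
    (hφ : ∀ r > 0, HasDerivAt φ (g r * r) r) (hg : HasDerivAt g g' ‖x‖) :
    lapl (fun y => φ ‖y‖) x = g' * ‖x‖ + N * g ‖x‖ := by
  have hnorm : ∀ y : EuclideanSpace ℝ (Fin N), y ≠ 0 →
      HasFDerivAt (fun z : EuclideanSpace ℝ (Fin N) => ‖z‖) (‖y‖⁻¹ • innerSL ℝ y) y := by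
    intro y hy
    have hy' : ‖y‖ ≠ 0 := norm_ne_zero_iff.2 hy
    have h := (hasStrictFDerivAt_norm_sq y).hasFDerivAt.sqrt (pow_ne_zero 2 hy')
    simp only [Real.sqrt_sq (norm_nonneg _)] at h
    refine h.congr_fderiv ?_
    ext v
    simp
    field_simp
  have hfst : ∀ i : Fin N, ∀ y : EuclideanSpace ℝ (Fin N), y ≠ 0 →
      fderiv ℝ (fun z : EuclideanSpace ℝ (Fin N) => φ ‖z‖) y (EuclideanSpace.single i 1)
        = g ‖y‖ * y i := by
    intro i y hy
    have hy' : 0 < ‖y‖ := norm_pos_iff.2 hy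
    have h : HasFDerivAt (fun z : EuclideanSpace ℝ (Fin N) => φ ‖z‖) _ y :=
      (hφ _ hy').comp_hasFDerivAt y (hnorm y hy)
    rw [h.fderiv]
    simp [EuclideanSpace.inner_single_right]
    field_simp
  have hx' : 0 < ‖x‖ := norm_pos_iff.2 hx
  have hsnd : ∀ i : Fin N,
      fderiv ℝ (fun y => fderiv ℝ (fun z : EuclideanSpace ℝ (Fin N) => φ ‖z‖) y
        (EuclideanSpace.single i (1 : ℝ))) x (EuclideanSpace.single i (1 : ℝ))
        = g' * ‖x‖⁻¹ * x i ^ 2 + g ‖x‖ := by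
    intro i
    have heq : (fun y => fderiv ℝ (fun z : EuclideanSpace ℝ (Fin N) => φ ‖z‖) y
        (EuclideanSpace.single i (1 : ℝ))) =ᶠ[nhds x] fun y => g ‖y‖ * y i := by
      filter_upwards [isOpen_ne.mem_nhds hx] with y hy using hfst i y hy
    have hgn : HasFDerivAt (fun z : EuclideanSpace ℝ (Fin N) => g ‖z‖) _ x :=
      hg.comp_hasFDerivAt x (hnorm x hx)
    have hcoord : HasFDerivAt (fun z : EuclideanSpace ℝ (Fin N) => z i)
        (EuclideanSpace.proj i : EuclideanSpace ℝ (Fin N) →L[ℝ] ℝ) x :=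
      (EuclideanSpace.proj i : EuclideanSpace ℝ (Fin N) →L[ℝ] ℝ).hasFDerivAt
    have hmul : HasFDerivAt (fun y : EuclideanSpace ℝ (Fin N) => g ‖y‖ * y i) _ x :=
      hgn.mul hcoord
    rw [heq.fderiv_eq, hmul.fderiv]
    simp [EuclideanSpace.inner_single_right]
    ring
  simp only [lapl, hsnd, Finset.sum_add_distrib, ← Finset.mul_sum,
    ← EuclideanSpace.real_norm_sq_eq]
  simp
  field_simp

/-- In dimension at least two, `K (1 + |x|) ^ a` is subharmonic away from the origin. -/
lemma lapl_one_add_norm_rpow_nonneg {N : ℕ} (hN : 2 ≤ N) {K a : ℝ} (hK : 0 ≤ K) (ha : 0 ≤ a)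
    {x : EuclideanSpace ℝ (Fin N)} (hx : x ≠ 0) :
    0 ≤ lapl (fun y => K * (1 + ‖y‖) ^ a) x := by
  have hx' : 0 < ‖x‖ := norm_pos_iff.2 hx
  have hpow : ∀ b : ℝ, ∀ r > 0, HasDerivAt (fun s : ℝ => (1 + s) ^ b) (b * (1 + r) ^ (b - 1)) r := by
    intro b r hr
    simpa using ((hasDerivAt_id r).const_add 1).rpow_const (p := b)
      (Or.inl (by simp only [id]; positivity))
  have hφ : ∀ r > 0, HasDerivAt (fun s : ℝ => K * (1 + s) ^ a)
      (K * a * (1 + r) ^ (a - 1) / r * r) r := by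
    intro r hr
    refine ((hpow a r hr).const_mul K).congr_deriv ?_
    rw [div_mul_cancel₀ _ hr.ne', mul_assoc]
  have hg := ((hpow (a - 1) _ hx').const_mul (K * a)).div (hasDerivAt_id ‖x‖) hx'.ne'
  rw [lapl_comp_norm (g := fun r => K * a * (1 + r) ^ (a - 1) / r) hx hφ hg]
  have hN' : (2 : ℝ) ≤ N := by exact_mod_cast hN
  have hsplit : (1 + ‖x‖) ^ (a - 1) = (1 + ‖x‖) ^ (a - 1 - 1) * (1 + ‖x‖) := by
    rw [← Real.rpow_add_one (by positivity)]
    ring_nf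
  have key : 0 ≤ K * a * (1 + ‖x‖) ^ (a - 1 - 1) / ‖x‖
      * (a * ‖x‖ + (N - 2) * (1 + ‖x‖) + 1) := by
    have : 0 ≤ (N : ℝ) - 2 := by linarith
    positivity
  convert key using 1
  simp only [id, hsplit]
  field_simp
  ring

/-- The explicit function U(x,t) = ((1-p)t)^(1/(1-p)) (1+|x|)^(σ/(1-p)) is a classical
subsolution with zero initial datum. -/
theorem explicit_subsolution
    {N : ℕ} (hN : 2 ≤ N) {m p σ : ℝ} (hm : 1 < m) (hp0 : 0 < p) (hp1 : p < 1)
    (hσ : 0 < σ)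
    (U : EuclideanSpace ℝ (Fin N) → ℝ → ℝ)
    (hU : ∀ (x : EuclideanSpace ℝ (Fin N)) (t : ℝ),
      U x t = ((1 - p) * t) ^ (1 / (1 - p)) * (1 + ‖x‖) ^ (σ / (1 - p))) :
    (∀ x : EuclideanSpace ℝ (Fin N), ∀ t > (0:ℝ),
      deriv (U x) t = (1 + ‖x‖) ^ σ * U x t ^ p) ∧
    (∀ x : EuclideanSpace ℝ (Fin N), x ≠ 0 → ∀ t > (0:ℝ),
      0 ≤ lapl (fun y => U y t ^ m) x) ∧
    (∀ x : EuclideanSpace ℝ (Fin N), x ≠ 0 → ∀ t > (0:ℝ),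
      deriv (U x) t ≤ lapl (fun y => U y t ^ m) x + (1 + ‖x‖) ^ σ * U x t ^ p) ∧
    (∀ x : EuclideanSpace ℝ (Fin N),
      Filter.Tendsto (fun t => U x t) (nhdsWithin 0 (Ioi 0)) (nhds 0)) := by
  have hq : 0 < 1 - p := by linarith
  have hderiv : ∀ x : EuclideanSpace ℝ (Fin N), ∀ t > (0:ℝ),
      deriv (U x) t = (1 + ‖x‖) ^ σ * U x t ^ p := by
    intro x t ht
    have hqt : 0 < (1 - p) * t := by positivity
    have hx : 0 < 1 + ‖x‖ := by positivity
    have h := ((((hasDerivAt_id' t).const_mul (1 - p)).rpow_const (p := 1 / (1 - p))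
      (Or.inl hqt.ne')).mul_const ((1 + ‖x‖) ^ (σ / (1 - p))))
    rw [hU, funext (hU x), h.deriv,
      Real.mul_rpow (x := ((1 - p) * t) ^ (1 / (1 - p))) (by positivity) (by positivity),
      ← Real.rpow_mul hqt.le,
      ← Real.rpow_mul hx.le, mul_left_comm, ← Real.rpow_add hx]
    have e1 : 1 / (1 - p) - 1 = 1 / (1 - p) * p := by field_simp; ring
    have e2 : σ + σ / (1 - p) * p = σ / (1 - p) := by field_simp; ring
    rw [e1, e2]
    field_simp
  have hlapl : ∀ x : EuclideanSpace ℝ (Fin N), x ≠ 0 → ∀ t > (0:ℝ),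
      0 ≤ lapl (fun y => U y t ^ m) x := by
    intro x hx t ht
    have hUm : (fun y => U y t ^ m) = fun y =>
        (((1 - p) * t) ^ (1 / (1 - p))) ^ m * (1 + ‖y‖) ^ (σ / (1 - p) * m) := by
      funext y
      rw [hU, Real.mul_rpow (by positivity) (by positivity),
        Real.rpow_mul (x := 1 + ‖y‖) (by positivity)]
    rw [hUm]
    exact lapl_one_add_norm_rpow_nonneg hN (by positivity) (by positivity) hx
  refine ⟨hderiv, hlapl, fun x hx t ht => ?_, fun x => ?_⟩
  · rw [hderiv x t ht]
    linarith [hlapl x hx t ht]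
  · have hcont : Continuous (U x) := by
      rw [funext (hU x)]
      exact ((continuous_const.mul continuous_id).rpow_const
        fun _ => Or.inr (by positivity)).mul continuous_const
    have h0 : U x 0 = 0 := by
      rw [hU, mul_zero, Real.zero_rpow (by positivity), zero_mul]
    simpa only [h0] using (hcont.tendsto 0).mono_left nhdsWithin_le_nhds
end
end

section
/- Let N ≥ 2, m > 1, 0 < p < 1 with m + p < 2, and let σ > 0. Then for every x ∈ ℝ^N with x ≠ 0, every real v > 0 and every vector g ∈ ℝ^N, the following quadratic-form inequality holds: ((2−m−p)(1−p)/(m−1)²) (1+|x|)² |g|² − 2σ ((2−m−p)/(m−1)) (1+|x|) v ⟨x/|x|, g⟩ + σ (σ − 1 + (N−1)(1+|x|)/|x|) v² ≥ 0. Indeed, writing a = (2−m−p)/(m−1) > 0, the left-hand side is bounded below by ( a(1+|x|)|g| − σ v )² + a (1+|x|)² |g|² + σ ( (N−1)(1+|x|)/|x| − 1 ) v², and each of these three terms is non-negative when N ≥ 2 and σ > 0. -/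
open scoped RealInnerProductSpace

theorem inner_inv_norm_smul_le_norm {E : Type*} [NormedAddCommGroup E] [InnerProductSpace ℝ E]
    (x g : E) : ⟪‖x‖⁻¹ • x, g⟫ ≤ ‖g‖ := by
  refine (real_inner_le_norm _ _).trans (mul_le_of_le_one_left (norm_nonneg g) ?_)
  rw [norm_smul, norm_inv, norm_norm]
  exact inv_mul_le_one

/-- Non-negativity of the quadratic form arising as the remainder R₂ in the
Aronson–Bénilan computation for the weighted equation, N ≥ 2, m + p < 2, σ > 0. -/
theorem remainder_quadratic_form_nonneg
    {N : ℕ} (hN : 2 ≤ N) {m p σ : ℝ} (hm : 1 < m) (hp0 : 0 < p) (hp1 : p < 1)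
    (hmp : m + p < 2) (hσ : 0 < σ)
    (a : ℝ) (ha : a = (2 - m - p) / (m - 1))
    (x g : EuclideanSpace ℝ (Fin N)) (hx : x ≠ 0) (v : ℝ) (hv : 0 < v) :
    ((a * (1 + ‖x‖) * ‖g‖ - σ * v) ^ 2 + a * (1 + ‖x‖) ^ 2 * ‖g‖ ^ 2
        + σ * (((N : ℝ) - 1) * (1 + ‖x‖) / ‖x‖ - 1) * v ^ 2
      ≤ ((2 - m - p) * (1 - p) / (m - 1) ^ 2) * (1 + ‖x‖) ^ 2 * ‖g‖ ^ 2
        - 2 * σ * ((2 - m - p) / (m - 1)) * (1 + ‖x‖) * v * ⟪‖x‖⁻¹ • x, g⟫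
        + σ * (σ - 1 + ((N : ℝ) - 1) * (1 + ‖x‖) / ‖x‖) * v ^ 2)
    ∧ 0 ≤ (a * (1 + ‖x‖) * ‖g‖ - σ * v) ^ 2
    ∧ 0 ≤ a * (1 + ‖x‖) ^ 2 * ‖g‖ ^ 2
    ∧ 0 ≤ σ * (((N : ℝ) - 1) * (1 + ‖x‖) / ‖x‖ - 1) * v ^ 2
    ∧ 0 ≤ ((2 - m - p) * (1 - p) / (m - 1) ^ 2) * (1 + ‖x‖) ^ 2 * ‖g‖ ^ 2
        - 2 * σ * ((2 - m - p) / (m - 1)) * (1 + ‖x‖) * v * ⟪‖x‖⁻¹ • x, g⟫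
        + σ * (σ - 1 + ((N : ℝ) - 1) * (1 + ‖x‖) / ‖x‖) * v ^ 2 := by
  have hm' : 0 < m - 1 := sub_pos.2 hm
  have ha0 : 0 < a := ha ▸ div_pos (by linarith) hm'
  have hx' : 0 < ‖x‖ := norm_pos_iff.2 hx
  have hcoef : (2 - m - p) * (1 - p) / (m - 1) ^ 2 = a * (a + 1) := by
    rw [ha]
    field_simp
    ring
  have hN' : (2 : ℝ) ≤ N := by exact_mod_cast hN
  have hk : 1 ≤ ((N : ℝ) - 1) * (1 + ‖x‖) / ‖x‖ := by
    rw [one_le_div hx']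
    nlinarith
  have hcs : 2 * σ * a * (1 + ‖x‖) * v * ⟪‖x‖⁻¹ • x, g⟫ ≤ 2 * σ * a * (1 + ‖x‖) * v * ‖g‖ :=
    mul_le_mul_of_nonneg_left (inner_inv_norm_smul_le_norm x g) (by positivity)
  rw [hcoef, ← ha]
  have hsq : 0 ≤ (a * (1 + ‖x‖) * ‖g‖ - σ * v) ^ 2 := sq_nonneg _
  have hgrad : 0 ≤ a * (1 + ‖x‖) ^ 2 * ‖g‖ ^ 2 := by positivity
  have hpot : 0 ≤ σ * (((N : ℝ) - 1) * (1 + ‖x‖) / ‖x‖ - 1) * v ^ 2 :=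
    mul_nonneg (mul_nonneg hσ.le (sub_nonneg.2 hk)) (sq_nonneg v)
  generalize ((N : ℝ) - 1) * (1 + ‖x‖) / ‖x‖ = k at *
  have hle : (a * (1 + ‖x‖) * ‖g‖ - σ * v) ^ 2 + a * (1 + ‖x‖) ^ 2 * ‖g‖ ^ 2
        + σ * (k - 1) * v ^ 2
      ≤ a * (a + 1) * (1 + ‖x‖) ^ 2 * ‖g‖ ^ 2
        - 2 * σ * a * (1 + ‖x‖) * v * ⟪‖x‖⁻¹ • x, g⟫ + σ * (σ - 1 + k) * v ^ 2 := by
    linear_combination hcs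
  exact ⟨hle, hsq, hgrad, hpot, by linarith⟩
end
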